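/- Say that a smooth immersion h = (h₁,h₂) : [0,1] → ℂ satisfies the Morse–Bott condition at r if the following holds: whenever h'(r) has rational slope (i.e. there exists (m,n) ∈ ℤ²∖{(0,0)} with m·h₁'(r) + n·h₂'(r) = 0), one has h₁''(r)·h₂'(r) − h₁'(r)·h₂''(r) ≠ 0. Let h, g : [0,1] → ℂ be smooth maps such that (h,g) satisfies the stabilization conditions on [0,1], and suppose there exists ε₀ > 0 such that h satisfies the Morse–Bott condition at every r ∈ [0,ε₀] ∪ [1−ε₀,1]. Then for every ε > 0 there exist smooth families h_t, g_t : [0,1] → ℂ, t ∈ [0,1], such that: h_0 = h and g_0 = g; for every t, h_t = h and g_t = g on a neighbourhood of {0,1}; (h_t, g_t) satisfies the stabilization conditions on [0,1] for every t; sup_{t∈[0,1]} (‖∂_t h_t‖_{C¹} + ‖∂_t g_t‖_{C¹}) < ε; and the map h_1 (at t = 1) satisfies the Morse–Bott condition at every r ∈ [0,1]. -/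

import Mathlib

/-- The real inner product `⟨z,w⟩ = Re (z · conj w)` on `ℂ ≅ ℝ²`. -/
noncomputable def rinner (z w : ℂ) : ℝ := (z * (starRingEnd ℂ) w).re

/-- The pair `(h,g)` satisfies the stabilization conditions on `S`:
`⟨g'(r), i·h'(r)⟩ = 0` and `⟨g(r), i·h'(r)⟩ > 0` for all `r ∈ S`. -/
def StabOn (h g : ℝ → ℂ) (S : Set ℝ) : Prop :=
  ∀ r ∈ S, rinner (deriv g r) (Complex.I * deriv h r) = 0 ∧
    0 < rinner (g r) (Complex.I * deriv h r)

/-- The `C¹`-norm of a map on `[0,1]`: `sup |f| + sup |f'|`. -/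
noncomputable def C1Norm (f : ℝ → ℂ) : ℝ :=
  (⨆ r : Set.Icc (0:ℝ) 1, ‖f r.1‖) + (⨆ r : Set.Icc (0:ℝ) 1, ‖deriv f r.1‖)

/-- `h` satisfies the Morse–Bott condition at `r`: if `h'(r)` has rational
slope then `h₁''(r)·h₂'(r) − h₁'(r)·h₂''(r) ≠ 0`. -/
def MBat (h : ℝ → ℂ) (r : ℝ) : Prop :=
  (∃ m n : ℤ, ¬(m = 0 ∧ n = 0) ∧
      (m : ℝ) * (deriv h r).re + (n : ℝ) * (deriv h r).im = 0) →
    (deriv (deriv h) r).re * (deriv h r).im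
      - (deriv h r).re * (deriv (deriv h) r).im ≠ 0

open Set Filter Topology

/-- The linear combination `∑ i, c i * w i r` of real functions with complex coefficients. -/
noncomputable def pert {ι : Type*} [Fintype ι] (w : ι → ℝ → ℝ) (c : ι → ℂ) (r : ℝ) : ℂ :=
  ∑ i, c i * (w i r : ℂ)

/-- The real linear form `z ↦ m z₁ + n z₂`. -/
def slopeForm (m n : ℝ) (z : ℂ) : ℝ := m * z.re + n * z.im

section slopeForm

variable (m n : ℝ)

theorem slopeForm_add (z w : ℂ) :
    slopeForm m n (z + w) = slopeForm m n z + slopeForm m n w := by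
  simp [slopeForm]; ring

theorem slopeForm_real_mul (a : ℝ) (z : ℂ) :
    slopeForm m n (a * z) = a * slopeForm m n z := by
  simp [slopeForm]; ring

theorem continuous_slopeForm : Continuous (slopeForm m n) := by
  unfold slopeForm; fun_prop

theorem HasDerivAt.slopeForm {f : ℝ → ℂ} {f' : ℂ} {r : ℝ} (hf : HasDerivAt f f' r) :
    HasDerivAt (fun x => slopeForm m n (f x)) (slopeForm m n f') r := by
  have hre : HasDerivAt (fun x => (f x).re) f'.re r :=
    Complex.reCLM.hasFDerivAt.comp_hasDerivAt r hf
  have him : HasDerivAt (fun x => (f x).im) f'.im r :=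
    Complex.imCLM.hasFDerivAt.comp_hasDerivAt r hf
  exact (hre.const_mul m).add (him.const_mul n)

theorem slopeForm_eq_zero_of_cross_eq_zero {z w : ℂ} (hz : z ≠ 0)
    (hzw : w.re * z.im - z.re * w.im = 0) (h : slopeForm m n z = 0) :
    slopeForm m n w = 0 := by
  unfold slopeForm at *
  by_cases hre : z.re = 0
  · have him : z.im ≠ 0 := fun him => hz (Complex.ext hre him)
    apply mul_left_cancel₀ him
    linear_combination w.im * h + m * hzw
  · apply mul_left_cancel₀ hre
    linear_combination w.re * h - n * hzw

end slopeForm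

section pert

variable {ι : Type*} [Fintype ι]

@[simp]
theorem pert_zero (w : ι → ℝ → ℝ) (r : ℝ) : pert w 0 r = 0 := by
  simp [pert]

theorem pert_eq_zero {w : ι → ℝ → ℝ} {r : ℝ} (hw : ∀ i, w i r = 0) (c : ι → ℂ) :
    pert w c r = 0 := by
  simp [pert, hw]

theorem pert_smul (w : ι → ℝ → ℝ) (t : ℝ) (c : ι → ℂ) (r : ℝ) :
    pert w (t • c) r = t * pert w c r := by
  simp [pert, Finset.mul_sum, mul_assoc]

theorem pert_mul (A : ℝ → ℝ) (p : ι → ℝ → ℝ) (c : ι → ℂ) (r : ℝ) :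
    pert (fun i x => A x * p i x) c r = A r * pert p c r := by
  simp only [pert, Finset.mul_sum]
  exact Finset.sum_congr rfl fun i _ => by push_cast; ring

theorem pert_add_smul_single [DecidableEq ι] (w : ι → ℝ → ℝ) (c : ι → ℂ) (s : ℝ) (i : ι)
    (v : ℂ) (r : ℝ) :
    pert w (c + s • (Pi.single i v : ι → ℂ)) r = pert w c r + ((s * w i r : ℝ) : ℂ) * v := by
  simp only [pert, Pi.add_apply, Pi.smul_apply, add_mul, Finset.sum_add_distrib]
  congr 1
  rw [Finset.sum_eq_single i]
  · simp; ring
  · intro j _ hj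
    simp [Pi.single_eq_of_ne hj]
  · simp

theorem continuous_pert {w : ι → ℝ → ℝ} (hw : ∀ i, Continuous (w i)) :
    Continuous fun z : (ι → ℂ) × ℝ => pert w z.1 z.2 := by
  unfold pert; fun_prop

theorem contDiff_pert {w : ι → ℝ → ℝ} {k : WithTop ℕ∞} (hw : ∀ i, ContDiff ℝ k (w i))
    (c : ι → ℂ) : ContDiff ℝ k (pert w c) := by
  unfold pert
  refine ContDiff.sum fun i _ => contDiff_const.mul ?_
  exact Complex.ofRealCLM.contDiff.comp (hw i)

theorem hasDerivAt_pert {w w' : ι → ℝ → ℝ} {r : ℝ} (hw : ∀ i, HasDerivAt (w i) (w' i r) r)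
    (c : ι → ℂ) : HasDerivAt (pert w c) (pert w' c r) r := by
  unfold pert
  exact HasDerivAt.fun_sum fun i _ => (hw i).ofReal_comp.const_mul (c i)

theorem eventually_norm_pert_le {w : ι → ℝ → ℝ} (hw : ∀ i, Continuous (w i)) {δ : ℝ}
    (hδ : 0 < δ) : ∀ᶠ c in 𝓝 (0 : ι → ℂ), ∀ r ∈ Icc (0 : ℝ) 1, ‖pert w c r‖ ≤ δ := by
  refine isCompact_Icc.eventually_forall_of_forall_eventually fun r _ => ?_
  have h := (continuous_pert hw).norm.tendsto ((0 : ι → ℂ), r)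
  simp only [pert_zero, norm_zero] at h
  exact (h.eventually (gt_mem_nhds hδ)).mono fun _ => le_of_lt

end pert

/-- One-dimensional Sard theorem: the set of critical values is null. -/
theorem volume_image_critical_eq_zero {F F' : ℝ → ℝ} {s : Set ℝ}
    (hF : ∀ x ∈ s, HasDerivAt F (F' x) x) :
    MeasureTheory.volume (F '' {x ∈ s | F' x = 0}) = 0 := by
  refine MeasureTheory.addHaar_image_eq_zero_of_det_fderivWithin_eq_zero
    (f' := fun x => ContinuousLinearMap.toSpanSingleton ℝ (F' x)) _
    (fun x hx => (hF x hx.1).hasFDerivAt.hasFDerivWithinAt) ?_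
  rintro x ⟨-, hx⟩
  simp [hx, ContinuousLinearMap.det]

section generic

variable {ι : Type*} [Fintype ι] {f f' : ℝ → ℂ} {w w' : ι → ℝ → ℝ}

theorem isOpen_setOf_regular (hf : Continuous f) (hf' : Continuous f')
    (hw : ∀ i, Continuous (w i)) (hw' : ∀ i, Continuous (w' i)) {J : Set ℝ}
    (hJ : IsCompact J) (m n : ℝ) :
    IsOpen {c : ι → ℂ | ∀ r ∈ J, ¬(slopeForm m n (f r + pert w c r) = 0 ∧
      slopeForm m n (f' r + pert w' c r) = 0)} := by
  rw [isOpen_iff_eventually]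
  intro c hc
  refine hJ.eventually_forall_of_forall_eventually fun r hr => ?_
  have key : IsClosed {z : (ι → ℂ) × ℝ | slopeForm m n (f z.2 + pert w z.1 z.2) = 0 ∧
      slopeForm m n (f' z.2 + pert w' z.1 z.2) = 0} :=
    (isClosed_eq ((continuous_slopeForm m n).comp
      ((hf.comp continuous_snd).add (continuous_pert hw))) continuous_const).inter
    (isClosed_eq ((continuous_slopeForm m n).comp
      ((hf'.comp continuous_snd).add (continuous_pert hw'))) continuous_const)
  exact key.isOpen_compl.mem_nhds (hc r hr)

theorem dense_setOf_regular (hf : ∀ r, HasDerivAt f (f' r) r)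
    (hw : ∀ i r, HasDerivAt (w i) (w' i r) r) {J : Set ℝ} {i : ι}
    (hJ : ∀ r ∈ J, w i r ≠ 0) {m n : ℝ} (hmn : ¬(m = 0 ∧ n = 0)) :
    Dense {c : ι → ℂ | ∀ r ∈ J, ¬(slopeForm m n (f r + pert w c r) = 0 ∧
      slopeForm m n (f' r + pert w' c r) = 0)} := by
  classical
  rw [dense_iff_inter_open]
  rintro U hU ⟨c, hc⟩
  set v : ℂ := ⟨m, n⟩
  have hv : slopeForm m n v ≠ 0 := by
    intro h
    have h0 : m * m + n * n = 0 := h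
    exact hmn ⟨by nlinarith [mul_self_nonneg m, mul_self_nonneg n],
      by nlinarith [mul_self_nonneg m, mul_self_nonneg n]⟩
  set a : ℝ → ℝ := fun r => slopeForm m n (f r + pert w c r)
  set a' : ℝ → ℝ := fun r => slopeForm m n (f' r + pert w' c r)
  set b : ℝ → ℝ := fun r => w i r * slopeForm m n v
  set b' : ℝ → ℝ := fun r => w' i r * slopeForm m n v
  have ha : ∀ r, HasDerivAt a (a' r) r := fun r =>
    ((hf r).add (hasDerivAt_pert (fun i => hw i r) c)).slopeForm m n
  have hb : ∀ r, HasDerivAt b (b' r) r := fun r => (hw i r).mul_const _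
  have hb0 : ∀ r ∈ J, b r ≠ 0 := fun r hr => mul_ne_zero (hJ r hr) hv
  have hnull := volume_image_critical_eq_zero (s := J)
    fun r hr => ((ha r).neg.div (hb r) (hb0 r hr))
  set bad := (-a / b) '' {x ∈ J | (-a' x * b x - (-a) x * b' x) / b x ^ 2 = 0}
  set V := (fun s : ℝ => c + s • (Pi.single i v : ι → ℂ)) ⁻¹' U
  have hV : IsOpen V := hU.preimage (by fun_prop)
  have hVpos : 0 < MeasureTheory.volume V := hV.measure_pos _ ⟨0, by simpa [V] using hc⟩
  obtain ⟨s, hsV, hs⟩ : ∃ s ∈ V, s ∉ bad := by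
    by_contra! hcon
    exact hVpos.ne' (MeasureTheory.measure_mono_null hcon hnull)
  refine ⟨_, hsV, fun r hr h => hs ?_⟩
  beta_reduce at h
  rw [pert_add_smul_single, pert_add_smul_single, ← add_assoc, ← add_assoc, slopeForm_add,
    slopeForm_add _ _ (f' r + _), slopeForm_real_mul, slopeForm_real_mul] at h
  obtain ⟨h1, h2⟩ := h
  have e1 : a r + s * b r = 0 := by rw [← h1]; simp only [a, b]; ring
  have e2 : a' r + s * b' r = 0 := by rw [← h2]; simp only [a', b']; ring
  refine ⟨r, ⟨hr, ?_⟩, ?_⟩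
  · rw [div_eq_zero_iff]
    left
    simp only [Pi.neg_apply]
    linear_combination (-b r) * e2 + b' r * e1
  · simp only [Pi.div_apply, Pi.neg_apply]
    rw [div_eq_iff (hb0 r hr)]
    linarith

/-- For a dense set of coefficients, the perturbed curve is transverse to all rational
directions wherever some perturbing function is nonzero. -/
theorem dense_setOf_forall_rational_regular (hf : ∀ r, HasDerivAt f (f' r) r)
    (hf' : Continuous f') (hw : ∀ i r, HasDerivAt (w i) (w' i r) r)
    (hw' : ∀ i, Continuous (w' i)) :
    Dense {c : ι → ℂ | ∀ m n : ℤ, ¬(m = 0 ∧ n = 0) → ∀ r ∈ Icc (0 : ℝ) 1, (∃ i, w i r ≠ 0) →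
      ¬(slopeForm m n (f r + pert w c r) = 0 ∧ slopeForm m n (f' r + pert w' c r) = 0)} := by
  have hfc : Continuous f := continuous_iff_continuousAt.2 fun r => (hf r).continuousAt
  have hwc : ∀ i, Continuous (w i) := fun i =>
    continuous_iff_continuousAt.2 fun r => (hw i r).continuousAt
  set J : ι → ℕ → Set ℝ := fun i k => {r ∈ Icc (0 : ℝ) 1 | 1 / ((k : ℝ) + 1) ≤ |w i r|}
  have hJc : ∀ i k, IsCompact (J i k) := fun i k =>
    isCompact_Icc.inter_right (isClosed_le continuous_const (hwc i).abs)
  have hJ0 : ∀ i k, ∀ r ∈ J i k, w i r ≠ 0 := fun i k r hr =>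
    abs_pos.1 (lt_of_lt_of_le (by positivity) hr.2)
  refine (dense_iInter_of_isOpen
    (f := fun x : {z : ℤ × ℤ // ¬(z.1 = 0 ∧ z.2 = 0)} × ι × ℕ =>
      {c : ι → ℂ | ∀ r ∈ J x.2.1 x.2.2,
        ¬(slopeForm x.1.1.1 x.1.1.2 (f r + pert w c r) = 0 ∧
          slopeForm x.1.1.1 x.1.1.2 (f' r + pert w' c r) = 0)})
    (fun x => isOpen_setOf_regular hfc hf' hwc hw' (hJc _ _) _ _)
    (fun x => dense_setOf_regular hf hw (hJ0 _ _) (by exact_mod_cast x.1.2))).mono ?_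
  rintro c hc m n hmn r hr ⟨i, hi⟩
  obtain ⟨k, hk⟩ := exists_nat_one_div_lt (abs_pos.2 hi)
  exact mem_iInter.1 hc ⟨⟨(m, n), hmn⟩, i, k⟩ r ⟨hr, hk.le⟩

end generic

section polynomial

open Polynomial

/-- Integration over `[0,1]` against a continuous weight, as a linear form on polynomials. -/
noncomputable def weightedIntegral (A : ℝ → ℝ) (hA : Continuous A) : ℝ[X] →ₗ[ℝ] ℝ where
  toFun p := ∫ x in (0 : ℝ)..1, A x * p.eval x
  map_add' p q := by
    simp only [eval_add, mul_add]
    exact intervalIntegral.integral_add (by apply Continuous.intervalIntegrable; fun_prop)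
      (by apply Continuous.intervalIntegrable; fun_prop)
  map_smul' a p := by
    simp only [eval_smul, smul_eq_mul, RingHom.id_apply]
    rw [← intervalIntegral.integral_const_mul]
    exact intervalIntegral.integral_congr fun x _ => by ring

theorem tendsto_weightedIntegral_peak {A : ℝ → ℝ} (hA : Continuous A) {r : ℝ}
    (hr : r ∈ Icc (0 : ℝ) 1) :
    Tendsto (fun k : ℕ => weightedIntegral A hA ((1 - (X - C r) ^ 2) ^ k)) atTop (𝓝 0) := by
  have h := intervalIntegral.tendsto_integral_filter_of_dominated_convergence
    (a := 0) (b := 1) (μ := MeasureTheory.volume) (l := atTop) (f := fun _ => (0 : ℝ))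
    (F := fun (k : ℕ) x => A x * ((1 - (X - C r) ^ 2) ^ k : ℝ[X]).eval x) (fun x => |A x|)
    (Eventually.of_forall fun k => by
      apply Continuous.aestronglyMeasurable; fun_prop) ?_
    (hA.abs.intervalIntegrable _ _) ?_
  · simpa [weightedIntegral] using h
  · refine Eventually.of_forall fun k => Eventually.of_forall fun x hx => ?_
    rw [uIoc_of_le zero_le_one] at hx
    simp only [eval_pow, eval_sub, eval_one, eval_X, eval_C, norm_mul, Real.norm_eq_abs]
    refine mul_le_of_le_one_right (abs_nonneg _) ?_
    rw [abs_pow]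
    refine pow_le_one₀ (abs_nonneg _) (abs_le.2 ⟨?_, ?_⟩) <;>
      nlinarith [hx.1, hx.2, hr.1, hr.2, sq_nonneg (x - r)]
  · have hne : ∀ᵐ x : ℝ, x ≠ r := by
      simp [MeasureTheory.ae_iff, MeasureTheory.measure_singleton]
    filter_upwards [hne] with x hxr hx
    rw [uIoc_of_le zero_le_one] at hx
    simp only [eval_pow, eval_sub, eval_one, eval_X, eval_C]
    have hpos : 0 < (x - r) ^ 2 := by
      have := sub_ne_zero.2 hxr
      positivity
    have := (tendsto_pow_atTop_nhds_zero_of_abs_lt_one (r := 1 - (x - r) ^ 2)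
      (abs_lt.2 ⟨by nlinarith [hx.1, hx.2, hr.1, hr.2], by linarith⟩)).const_mul (A x)
    simpa using this

theorem exists_polynomial_eval_ne_zero {A B : ℝ → ℝ} (hA : Continuous A) (hB : Continuous B)
    {r : ℝ} (hr : r ∈ Icc (0 : ℝ) 1) :
    ∃ p : ℝ[X], weightedIntegral A hA p = 0 ∧ weightedIntegral B hB p = 0 ∧ p.eval r ≠ 0 := by
  by_contra! hcon
  have hspan := mem_span_of_iInf_ker_le_ker (K := leval r)
    (L := fun b : Bool => bif b then weightedIntegral A hA else weightedIntegral B hB) (by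
      intro p hp
      simp only [Submodule.mem_iInf, LinearMap.mem_ker] at hp
      exact hcon p (hp true) (hp false))
  have hrange : range (fun b : Bool => bif b then weightedIntegral A hA
      else weightedIntegral B hB) = {weightedIntegral A hA, weightedIntegral B hB} := by
    ext; simp [or_comm]
  rw [hrange, Submodule.mem_span_pair] at hspan
  obtain ⟨a, b, hab⟩ := hspan
  have hlim := ((tendsto_weightedIntegral_peak hA hr).const_mul a).add
    ((tendsto_weightedIntegral_peak hB hr).const_mul b)
  have hone : ∀ k : ℕ, a * weightedIntegral A hA ((1 - (X - C r) ^ 2) ^ k) +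
      b * weightedIntegral B hB ((1 - (X - C r) ^ 2) ^ k) = 1 := fun k => by
    have := LinearMap.congr_fun hab ((1 - (X - C r) ^ 2) ^ k)
    simpa [leval_apply] using this
  simp only [hone] at hlim
  simpa using tendsto_nhds_unique hlim tendsto_const_nhds

theorem exists_finset_polynomial {A B : ℝ → ℝ} (hA : Continuous A) (hB : Continuous B) :
    ∃ S : Finset ℝ[X], (∀ p ∈ S, ∫ x in (0 : ℝ)..1, A x * p.eval x = 0) ∧
      (∀ p ∈ S, ∫ x in (0 : ℝ)..1, B x * p.eval x = 0) ∧
      ∀ r ∈ Icc (0 : ℝ) 1, ∃ p ∈ S, p.eval r ≠ 0 := by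
  classical
  choose! p hpA hpB hp using fun r (hr : r ∈ Icc (0 : ℝ) 1) =>
    exists_polynomial_eval_ne_zero hA hB hr
  obtain ⟨T, hT, hcover⟩ := (isCompact_Icc (a := (0 : ℝ)) (b := 1)).elim_nhds_subcover
    (fun r => {x | (p r).eval x ≠ 0})
    fun r hr => (isOpen_ne_fun (p r).continuous continuous_const).mem_nhds (hp r hr)
  refine ⟨T.image p, ?_, ?_, fun r hr => ?_⟩
  · simp only [Finset.mem_image]
    rintro _ ⟨x, hx, rfl⟩
    exact hpA x (hT x hx)
  · simp only [Finset.mem_image]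
    rintro _ ⟨x, hx, rfl⟩
    exact hpB x (hT x hx)
  · obtain ⟨x, hx, hxr⟩ := mem_iUnion₂.1 (hcover hr)
    exact ⟨p x, Finset.mem_image_of_mem p hx, hxr⟩

end polynomial

section primitive

variable {k : ℝ → ℝ} {a : ℝ}

theorem hasDerivAt_primitive (hk : Continuous k) (r : ℝ) :
    HasDerivAt (fun y => ∫ x in (0 : ℝ)..y, k x) (k r) r :=
  intervalIntegral.integral_hasDerivAt_right (hk.intervalIntegrable _ _)
    hk.stronglyMeasurable.stronglyMeasurableAtFilter hk.continuousAt

theorem contDiff_primitive (hk : ContDiff ℝ (⊤ : ℕ∞) k) :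
    ContDiff ℝ (⊤ : ℕ∞) (fun y => ∫ x in (0 : ℝ)..y, k x) := by
  refine contDiff_infty_iff_deriv.2
    ⟨fun r => (hasDerivAt_primitive hk.continuous r).differentiableAt, ?_⟩
  rwa [funext fun r => (hasDerivAt_primitive hk.continuous r).deriv]

theorem primitive_eq_zero (hk : Continuous k) (ha : 0 ≤ a) (hleft : ∀ x ≤ a, k x = 0)
    (hright : ∀ x, 1 - a ≤ x → k x = 0) (hint : ∫ x in (0 : ℝ)..1, k x = 0) {r : ℝ}
    (hr : r ≤ a ∨ 1 - a ≤ r) : ∫ x in (0 : ℝ)..r, k x = 0 := by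
  rcases hr with hr | hr
  · refine intervalIntegral.integral_zero_ae (Eventually.of_forall fun x hx => hleft x ?_)
    exact hx.2.trans (max_le ha hr)
  · have hsub := intervalIntegral.integral_interval_sub_left (μ := MeasureTheory.volume)
      (hk.intervalIntegrable 0 r) (hk.intervalIntegrable 0 1)
    rw [hint, sub_zero] at hsub
    rw [hsub]
    refine intervalIntegral.integral_zero_ae (Eventually.of_forall fun x hx => hright x ?_)
    exact (le_min (by linarith) hr).trans hx.1.le

end primitive

/-- A smooth function that is positive exactly on `(a, 1 - a)`. -/
noncomputable def cutoff (a r : ℝ) : ℝ :=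
  expNegInvGlue (r - a) * expNegInvGlue (1 - a - r)

section cutoff

variable (a r : ℝ)

theorem contDiff_cutoff : ContDiff ℝ (⊤ : ℕ∞) (cutoff a) :=
  (expNegInvGlue.contDiff.comp (contDiff_id.sub contDiff_const)).mul
    (expNegInvGlue.contDiff.comp (contDiff_const.sub contDiff_id))

theorem cutoff_nonneg : 0 ≤ cutoff a r :=
  mul_nonneg (expNegInvGlue.nonneg _) (expNegInvGlue.nonneg _)

variable {a r}

theorem cutoff_eq_zero_iff : cutoff a r = 0 ↔ r ≤ a ∨ 1 - a ≤ r := by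
  simp [cutoff, expNegInvGlue.zero_iff_nonpos]

end cutoff

theorem rinner_I_mul (z w : ℂ) : rinner z (Complex.I * w) = z.im * w.re - z.re * w.im := by
  simp [rinner]

theorem continuous_rinner : Continuous fun z : ℂ × ℂ => rinner z.1 z.2 := by
  unfold rinner; fun_prop

/-- Perturbing `h'` and `g'` proportionally, with factors `φ |h'|²` and `φ ⟨g', h'⟩`, preserves
their being parallel. -/
theorem rinner_add_eq_zero {h' g' : ℂ} (hpar : rinner g' (Complex.I * h') = 0) (φ : ℝ) (P : ℂ) :
    rinner (g' + (φ * (g'.re * h'.re + g'.im * h'.im) : ℝ) * P)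
      (Complex.I * (h' + (φ * (h'.re ^ 2 + h'.im ^ 2) : ℝ) * P)) = 0 := by
  rw [rinner_I_mul] at *
  simp only [Complex.add_re, Complex.add_im, Complex.re_ofReal_mul, Complex.im_ofReal_mul]
  linear_combination (1 + φ * (h'.re * P.re + h'.im * P.im)) * hpar

theorem eventually_forall_rinner_pos {ι : Type*} [Fintype ι] {g f : ℝ → ℂ} {v w : ι → ℝ → ℝ}
    (hg : Continuous g) (hf : Continuous f) (hv : ∀ i, Continuous (v i))
    (hw : ∀ i, Continuous (w i))
    (hpos : ∀ r ∈ Icc (0 : ℝ) 1, 0 < rinner (g r) (Complex.I * f r)) :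
    ∀ᶠ c in 𝓝 (0 : ι → ℂ), ∀ r ∈ Icc (0 : ℝ) 1,
      0 < rinner (g r + pert v c r) (Complex.I * (f r + pert w c r)) := by
  refine isCompact_Icc.eventually_forall_of_forall_eventually fun r hr => ?_
  have hc : Continuous fun z : (ι → ℂ) × ℝ =>
      rinner (g z.2 + pert v z.1 z.2) (Complex.I * (f z.2 + pert w z.1 z.2)) :=
    continuous_rinner.comp (((hg.comp continuous_snd).add (continuous_pert hv)).prodMk
      (continuous_const.mul ((hf.comp continuous_snd).add (continuous_pert hw))))
  exact (hc.tendsto (0, r)).eventually (lt_mem_nhds (by simpa using hpos r hr))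

theorem C1Norm_le {f f' : ℝ → ℂ} {δ : ℝ} (hf : ∀ r, HasDerivAt f (f' r) r)
    (h0 : ∀ r ∈ Icc (0 : ℝ) 1, ‖f r‖ ≤ δ) (h1 : ∀ r ∈ Icc (0 : ℝ) 1, ‖f' r‖ ≤ δ) :
    C1Norm f ≤ δ + δ := by
  have : Nonempty (Icc (0 : ℝ) 1) := ⟨0, by simp⟩
  refine add_le_add (ciSup_le fun r => h0 r r.2) (ciSup_le fun r => ?_)
  rw [(hf r).deriv]
  exact h1 r r.2

theorem contDiff_uncurry_add_mul {f k : ℝ → ℂ} {n : WithTop ℕ∞} (hf : ContDiff ℝ n f)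
    (hk : ContDiff ℝ n k) :
    ContDiff ℝ n (Function.uncurry fun t r : ℝ => f r + t * k r) :=
  (hf.comp contDiff_snd).add
    ((Complex.ofRealCLM.contDiff.comp contDiff_fst).mul (hk.comp contDiff_snd))

theorem deriv_add_ofReal_mul (x y : ℂ) (t : ℝ) : deriv (fun s : ℝ => x + s * y) t = y := by
  have := ((Complex.ofRealCLM.hasDerivAt (x := t)).mul_const y).const_add x
  simpa using this.deriv

theorem ContDiff.hasDerivAt_deriv {E : Type*} [NormedAddCommGroup E] [NormedSpace ℝ E]
    {f : ℝ → E} (hf : ContDiff ℝ (⊤ : ℕ∞) f) (r : ℝ) : HasDerivAt f (deriv f r) r :=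
  ((contDiff_infty_iff_deriv.1 hf).1 r).hasDerivAt

/-- any stabilized pair `(h,g)` which is Morse–Bott near the
boundary can be deformed, by a `C¹`-small stabilized homotopy fixed near the
boundary, to a pair which is Morse–Bott everywhere on `[0,1]`. -/
theorem stmt15 (h g : ℝ → ℂ)
    (h_sm : ContDiff ℝ (⊤ : ℕ∞) h) (g_sm : ContDiff ℝ (⊤ : ℕ∞) g)
    (hstab : StabOn h g (Set.Icc 0 1))
    (hMB : ∃ ε₀ : ℝ, 0 < ε₀ ∧
      ∀ r ∈ Set.Icc (0:ℝ) ε₀ ∪ Set.Icc (1 - ε₀) 1, MBat h r) :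
    ∀ ε : ℝ, 0 < ε →
      ∃ H G : ℝ → ℝ → ℂ,
        ContDiff ℝ (⊤ : ℕ∞) (Function.uncurry H) ∧
        ContDiff ℝ (⊤ : ℕ∞) (Function.uncurry G) ∧
        (∀ r ∈ Set.Icc (0:ℝ) 1, H 0 r = h r ∧ G 0 r = g r) ∧
        (∀ t ∈ Set.Icc (0:ℝ) 1, ∃ τ : ℝ, 0 < τ ∧
          Set.EqOn (H t) h (Set.Icc 0 τ ∪ Set.Icc (1 - τ) 1) ∧
          Set.EqOn (G t) g (Set.Icc 0 τ ∪ Set.Icc (1 - τ) 1)) ∧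
        (∀ t ∈ Set.Icc (0:ℝ) 1, StabOn (H t) (G t) (Set.Icc 0 1)) ∧
        (∀ t ∈ Set.Icc (0:ℝ) 1,
          C1Norm (fun r => deriv (fun s => H s r) t)
            + C1Norm (fun r => deriv (fun s => G s r) t) < ε) ∧
        (∀ r ∈ Set.Icc (0:ℝ) 1, MBat (H 1) r) := by
  intro ε hε
  obtain ⟨a, ha, hMB⟩ := hMB
  have dh_sm : ContDiff ℝ (⊤ : ℕ∞) (deriv h) := (contDiff_infty_iff_deriv.1 h_sm).2
  have dg_sm : ContDiff ℝ (⊤ : ℕ∞) (deriv g) := (contDiff_infty_iff_deriv.1 g_sm).2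
  have ddh_sm : ContDiff ℝ (⊤ : ℕ∞) (deriv (deriv h)) := (contDiff_infty_iff_deriv.1 dh_sm).2
  have sm_re : ∀ {f : ℝ → ℂ}, ContDiff ℝ (⊤ : ℕ∞) f → ContDiff ℝ (⊤ : ℕ∞) fun r => (f r).re :=
    fun hf => Complex.reCLM.contDiff.comp hf
  have sm_im : ∀ {f : ℝ → ℂ}, ContDiff ℝ (⊤ : ℕ∞) f → ContDiff ℝ (⊤ : ℕ∞) fun r => (f r).im :=
    fun hf => Complex.imCLM.contDiff.comp hf
  set A : ℝ → ℝ := fun r => cutoff a r * ((deriv h r).re ^ 2 + (deriv h r).im ^ 2) with hA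
  set B : ℝ → ℝ := fun r => cutoff a r *
    ((deriv g r).re * (deriv h r).re + (deriv g r).im * (deriv h r).im) with hB
  have A_sm : ContDiff ℝ (⊤ : ℕ∞) A :=
    (contDiff_cutoff a).mul (((sm_re dh_sm).pow 2).add ((sm_im dh_sm).pow 2))
  have B_sm : ContDiff ℝ (⊤ : ℕ∞) B := (contDiff_cutoff a).mul
    (((sm_re dg_sm).mul (sm_re dh_sm)).add ((sm_im dg_sm).mul (sm_im dh_sm)))
  obtain ⟨S, hSA, hSB, hS⟩ := exists_finset_polynomial A_sm.continuous B_sm.continuous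
  set p : S → ℝ → ℝ := fun i r => i.1.eval r
  have p_sm : ∀ i, ContDiff ℝ (⊤ : ℕ∞) (p i) := fun i => by
    simpa [p] using i.1.contDiff_aeval (𝕜 := ℝ) (⊤ : ℕ∞)
  set u' : S → ℝ → ℝ := fun i r => A r * p i r
  set v' : S → ℝ → ℝ := fun i r => B r * p i r
  have u'_sm : ∀ i, ContDiff ℝ (⊤ : ℕ∞) (u' i) := fun i => A_sm.mul (p_sm i)
  have v'_sm : ∀ i, ContDiff ℝ (⊤ : ℕ∞) (v' i) := fun i => B_sm.mul (p_sm i)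
  set u : S → ℝ → ℝ := fun i r => ∫ x in (0 : ℝ)..r, u' i x
  set v : S → ℝ → ℝ := fun i r => ∫ x in (0 : ℝ)..r, v' i x
  have u_sm : ∀ i, ContDiff ℝ (⊤ : ℕ∞) (u i) := fun i => contDiff_primitive (u'_sm i)
  have v_sm : ∀ i, ContDiff ℝ (⊤ : ℕ∞) (v i) := fun i => contDiff_primitive (v'_sm i)
  have hu : ∀ c r, HasDerivAt (pert u c) (pert u' c r) r := fun c r =>
    hasDerivAt_pert (fun i => hasDerivAt_primitive (u'_sm i).continuous r) c
  have hv : ∀ c r, HasDerivAt (pert v c) (pert v' c r) r := fun c r =>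
    hasDerivAt_pert (fun i => hasDerivAt_primitive (v'_sm i).continuous r) c
  have hu0 : ∀ i r, r ≤ a ∨ 1 - a ≤ r → u i r = 0 := fun i r hr =>
    primitive_eq_zero (u'_sm i).continuous ha.le
      (fun x hx => by simp [u', hA, cutoff_eq_zero_iff.2 (Or.inl hx)])
      (fun x hx => by simp [u', hA, cutoff_eq_zero_iff.2 (Or.inr hx)]) (hSA i.1 i.2) hr
  have hv0 : ∀ i r, r ≤ a ∨ 1 - a ≤ r → v i r = 0 := fun i r hr =>
    primitive_eq_zero (v'_sm i).continuous ha.le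
      (fun x hx => by simp [v', hB, cutoff_eq_zero_iff.2 (Or.inl hx)])
      (fun x hx => by simp [v', hB, cutoff_eq_zero_iff.2 (Or.inr hx)]) (hSB i.1 i.2) hr
  have hδ : 0 < ε / 5 := by positivity
  obtain ⟨η, hη, hsmall⟩ := Metric.eventually_nhds_iff_ball.1
    ((((eventually_norm_pert_le (fun i => (u_sm i).continuous) hδ).and
      (eventually_norm_pert_le (fun i => (u'_sm i).continuous) hδ)).and
      ((eventually_norm_pert_le (fun i => (v_sm i).continuous) hδ).and
      (eventually_norm_pert_le (fun i => (v'_sm i).continuous) hδ))).and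
      (eventually_forall_rinner_pos g_sm.continuous dh_sm.continuous
        (fun i => (v_sm i).continuous) (fun i => (u'_sm i).continuous)
        fun r hr => (hstab r hr).2))
  obtain ⟨c, hcη, hc⟩ := (dense_setOf_forall_rational_regular (w := u')
    (w' := fun i => deriv (u' i)) dh_sm.hasDerivAt_deriv ddh_sm.continuous
    (fun i => (u'_sm i).hasDerivAt_deriv)
    (fun i => (contDiff_infty_iff_deriv.1 (u'_sm i)).2.continuous)).inter_open_nonempty
    _ Metric.isOpen_ball ⟨0, Metric.mem_ball_self hη⟩
  obtain ⟨⟨⟨bu, bu'⟩, bv, bv'⟩, -⟩ := hsmall c hcη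
  have dH : ∀ t : ℝ, deriv (fun r => h r + t * pert u c r) =
      fun r => deriv h r + t * pert u' c r := fun t => funext fun r =>
    ((h_sm.hasDerivAt_deriv r).add ((hu c r).const_mul (t : ℂ))).deriv
  have dG : ∀ t : ℝ, deriv (fun r => g r + t * pert v c r) =
      fun r => deriv g r + t * pert v' c r := fun t => funext fun r =>
    ((g_sm.hasDerivAt_deriv r).add ((hv c r).const_mul (t : ℂ))).deriv
  have stab : ∀ t ∈ Icc (0 : ℝ) 1, StabOn (fun r => h r + t * pert u c r)
      (fun r => g r + t * pert v c r) (Icc 0 1) := by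
    intro t ht r hr
    have htc : t • c ∈ Metric.ball (0 : S → ℂ) η := by
      rw [mem_ball_zero_iff] at hcη ⊢
      rw [norm_smul, Real.norm_of_nonneg ht.1]
      exact (mul_le_of_le_one_left (norm_nonneg _) ht.2).trans_lt hcη
    rw [dH, dG]
    simp only [← pert_smul]
    refine ⟨?_, (hsmall _ htc).2 r hr⟩
    rw [pert_mul, pert_mul]
    exact rinner_add_eq_zero (hstab r hr).1 _ _
  refine ⟨fun t r => h r + t * pert u c r, fun t r => g r + t * pert v c r,
    contDiff_uncurry_add_mul h_sm (contDiff_pert u_sm c),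
    contDiff_uncurry_add_mul g_sm (contDiff_pert v_sm c), fun r _ => by simp,
    fun t _ => ⟨a, ha, fun r hr => ?_, fun r hr => ?_⟩, stab, fun t _ => ?_, fun r hr => ?_⟩
  · simp [pert_eq_zero fun i => hu0 i r (hr.imp And.right And.left)]
  · simp [pert_eq_zero fun i => hv0 i r (hr.imp And.right And.left)]
  · simp only [deriv_add_ofReal_mul]
    linarith [C1Norm_le (hu c) bu bu', C1Norm_le (hv c) bv bv']
  · have dH1 := dH 1
    simp only [Complex.ofReal_one, one_mul] at dH1
    have ddH1 : deriv (fun r => deriv h r + pert u' c r) r =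
        deriv (deriv h) r + pert (fun i => deriv (u' i)) c r :=
      ((dh_sm.hasDerivAt_deriv r).add
        (hasDerivAt_pert (fun i => (u'_sm i).hasDerivAt_deriv r) c)).deriv
    have hpos := (stab 1 (by simp) r hr).2
    simp only [Complex.ofReal_one, one_mul, MBat, dH1, ddH1] at hpos ⊢
    by_cases hAr : A r = 0
    · have dA : deriv A r = 0 := IsLocalMin.deriv_eq_zero <| Eventually.of_forall fun x => by
        rw [hAr]
        exact mul_nonneg (cutoff_nonneg a x) (by positivity)
      have hu'r : ∀ i, u' i r = 0 := fun i => by simp [u', hAr]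
      have du'r : ∀ i, deriv (u' i) r = 0 := fun i => by
        have := ((A_sm.hasDerivAt_deriv r).mul ((p_sm i).hasDerivAt_deriv r)).deriv
        rw [dA, hAr, zero_mul, zero_mul, add_zero] at this
        exact this
      rw [pert_eq_zero hu'r, pert_eq_zero du'r, add_zero, add_zero]
      have hh : (deriv h r).re ^ 2 + (deriv h r).im ^ 2 ≠ 0 := by
        intro h0
        have hre : (deriv h r).re = 0 := by nlinarith [sq_nonneg (deriv h r).im]
        have him : (deriv h r).im = 0 := by nlinarith [sq_nonneg (deriv h r).re]
        have := (hstab r hr).2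
        simp [rinner_I_mul, hre, him] at this
      exact hMB r ((cutoff_eq_zero_iff.1 ((mul_eq_zero.1 hAr).resolve_right hh)).imp
        (fun h1 => ⟨hr.1, h1⟩) fun h1 => ⟨h1, hr.2⟩)
    · rintro ⟨m, n, hmn, hslope⟩ hcross
      obtain ⟨q, hqS, hq⟩ := hS r hr
      refine hc m n hmn r hr ⟨⟨q, hqS⟩, mul_ne_zero hAr hq⟩
        ⟨hslope, slopeForm_eq_zero_of_cross_eq_zero m n ?_ hcross hslope⟩
      intro h0
      rw [h0] at hpos
      simp [rinner] at hpos
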